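/- Let n be a positive integer with n ≡ 1 (mod 4) and M = (n-1)/2 or n-1. Then, for an indeterminate a, Σ_{k=0}^{M} [6k+1]·(q,aq,q/a;q²)_k·(q^{1−n};q⁴)_k / ((q⁴,q⁴/a,aq⁴;q⁴)_k·(q^{2+n};q²)_k)·q^{k²+k+nk} = (q³,q⁵;q⁴)_{(n-1)/4} / (aq⁴,q⁴/a;q⁴)_{(n-1)/4} as rational functions of a and q. -/

import Mathlib

/-- The q-shifted factorial `(x;q)_k = (1-x)(1-xq)⋯(1-xq^{k-1})`. -/
def qPoch {K : Type*} [Field K] (x q : K) (k : ℕ) : K :=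
  ∏ i ∈ Finset.range k, (1 - x * q ^ i)

/-- The q-integer `[r] = 1 + q + ⋯ + q^{r-1}`. -/
def qint {K : Type*} [Field K] (q : K) (r : ℕ) : K :=
  ∑ i ∈ Finset.range r, q ^ i

/-- The field ℚ(a,q) of rational functions in two indeterminates over ℚ. -/
abbrev Qaq : Type := FractionRing (MvPolynomial (Fin 2) ℚ)

/-- The indeterminate `a` of ℚ(a,q). -/
noncomputable def av : Qaq := algebraMap (MvPolynomial (Fin 2) ℚ) Qaq (MvPolynomial.X 0)

/-- The indeterminate `q` of ℚ(a,q). -/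
noncomputable def qv : Qaq := algebraMap (MvPolynomial (Fin 2) ℚ) Qaq (MvPolynomial.X 1)

section qPochhammer

variable {K : Type*} [Field K]

lemma qPoch_succ (x q : K) (k : ℕ) : qPoch x q (k + 1) = qPoch x q k * (1 - x * q ^ k) :=
  Finset.prod_range_succ _ _

lemma qPoch_succ' (x q : K) (k : ℕ) : qPoch x q (k + 1) = (1 - x) * qPoch (x * q) q k := by
  simp only [qPoch, Finset.prod_range_succ', pow_zero, mul_one, pow_succ', mul_assoc]
  ring

lemma qPoch_ne_zero {x q : K} (h : ∀ i : ℕ, 1 - x * q ^ i ≠ 0) (k : ℕ) : qPoch x q k ≠ 0 :=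
  Finset.prod_ne_zero_iff.2 fun i _ => h i

lemma qPoch_inv_pow_eq_zero {p : K} (hp : p ≠ 0) {N k : ℕ} (h : N < k) :
    qPoch (p ^ N)⁻¹ p k = 0 :=
  Finset.prod_eq_zero (Finset.mem_range.2 h) (by
    rw [inv_mul_cancel₀ (pow_ne_zero N hp), sub_self])

lemma qint_mul_one_sub (q : K) (r : ℕ) : qint q r * (1 - q) = 1 - q ^ r :=
  geom_sum_mul_neg q r

/-- The summand of the cubic series without its very-well-poised factor; `Q` plays the role
of `q ^ (n - 1)`. -/
def cubicTerm (a q Q : K) (k : ℕ) : K :=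
  (qPoch q (q ^ 2) k * qPoch (a * q) (q ^ 2) k * qPoch (q / a) (q ^ 2) k) *
      qPoch Q⁻¹ (q ^ 4) k /
    ((qPoch (q ^ 4) (q ^ 4) k * qPoch (q ^ 4 / a) (q ^ 4) k * qPoch (a * q ^ 4) (q ^ 4) k) *
      qPoch (Q * q ^ 3) (q ^ 2) k) *
    (q ^ (k ^ 2 + k) * (Q * q) ^ k)

lemma cubicTerm_zero (a q Q : K) : cubicTerm a q Q 0 = 1 := by
  simp [cubicTerm, qPoch]

/-- The telescoping certificate for the step `Q ↦ Q * q ^ 4`. -/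
def cubicCert (a q Q : K) (k : ℕ) : K :=
  cubicTerm a q Q k * (Q * q ^ 3 * q ^ (2 * k) * (1 - q * q ^ (2 * k)) *
    (1 - a * q * q ^ (2 * k)) * (1 - q / a * q ^ (2 * k)) *
    (1 - Q * q ^ 3) * (1 - Q * q ^ 5)) /
    ((1 - Q * q ^ 3 * q ^ (2 * k)) * (1 - Q * q ^ 5 * q ^ (2 * k)))

lemma cubicTerm_succ (a q Q : K) (k : ℕ) :
    cubicTerm a q Q (k + 1) = cubicTerm a q Q k *
      ((1 - q * q ^ (2 * k)) * (1 - a * q * q ^ (2 * k)) * (1 - q / a * q ^ (2 * k)) *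
        (1 - Q⁻¹ * (q ^ (2 * k)) ^ 2) /
      ((1 - q ^ 4 * (q ^ (2 * k)) ^ 2) * (1 - q ^ 4 / a * (q ^ (2 * k)) ^ 2) *
        (1 - a * q ^ 4 * (q ^ (2 * k)) ^ 2) * (1 - Q * q ^ 3 * q ^ (2 * k))) *
      (q ^ (2 * k) * Q * q ^ 3)) := by
  have h2 : (q ^ 2) ^ k = q ^ (2 * k) := by rw [pow_mul]
  have h4 : (q ^ 4) ^ k = (q ^ (2 * k)) ^ 2 := by ring
  have h1 : q ^ ((k + 1) ^ 2 + (k + 1)) * (Q * q) ^ (k + 1) =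
      q ^ (k ^ 2 + k) * (Q * q) ^ k * (q ^ (2 * k) * Q * q ^ 3) := by ring
  simp only [cubicTerm, qPoch_succ, h2, h4, h1]
  simp only [div_eq_mul_inv, mul_inv]
  ring

lemma cubicTerm_shift_succ {a q Q : K} (hq : q ≠ 0) (hQ : ∀ i, 1 - Q * q ^ 3 * (q ^ 2) ^ i ≠ 0)
    (k : ℕ) :
    cubicTerm a q (Q * q ^ 4) (k + 1) = cubicTerm a q Q k *
      ((1 - q * q ^ (2 * k)) * (1 - a * q * q ^ (2 * k)) * (1 - q / a * q ^ (2 * k)) *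
        (1 - (Q * q ^ 4)⁻¹) * ((1 - Q * q ^ 3) * (1 - Q * q ^ 5)) /
      ((1 - q ^ 4 * (q ^ (2 * k)) ^ 2) * (1 - q ^ 4 / a * (q ^ (2 * k)) ^ 2) *
        (1 - a * q ^ 4 * (q ^ (2 * k)) ^ 2) * ((1 - Q * q ^ 3 * q ^ (2 * k)) *
        (1 - Q * q ^ 5 * q ^ (2 * k)) * (1 - Q * q ^ 7 * q ^ (2 * k)))) *
      ((q ^ (2 * k)) ^ 3 * Q * q ^ 7)) := by
  have h2 : (q ^ 2) ^ k = q ^ (2 * k) := by rw [pow_mul]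
  have h4 : (q ^ 4) ^ k = (q ^ (2 * k)) ^ 2 := by ring
  have h1 : q ^ ((k + 1) ^ 2 + (k + 1)) * (Q * q ^ 4 * q) ^ (k + 1) =
      q ^ (k ^ 2 + k) * (Q * q) ^ k * ((q ^ (2 * k)) ^ 3 * Q * q ^ 7) := by ring
  have hV : qPoch (Q * q ^ 4)⁻¹ (q ^ 4) (k + 1) =
      (1 - (Q * q ^ 4)⁻¹) * qPoch Q⁻¹ (q ^ 4) k := by
    rw [qPoch_succ', mul_inv, inv_mul_cancel_right₀ (pow_ne_zero 4 hq)]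
  have hW : (1 - Q * q ^ 3) * (1 - Q * q ^ 5) * qPoch (Q * q ^ 4 * q ^ 3) (q ^ 2) (k + 1) =
      qPoch (Q * q ^ 3) (q ^ 2) k * ((1 - Q * q ^ 3 * q ^ (2 * k)) *
        (1 - Q * q ^ 5 * q ^ (2 * k)) * (1 - Q * q ^ 7 * q ^ (2 * k))) := by
    have e : qPoch (Q * q ^ 3) (q ^ 2) (k + 3) =
        (1 - Q * q ^ 3) * ((1 - Q * q ^ 5) * qPoch (Q * q ^ 4 * q ^ 3) (q ^ 2) (k + 1)) := by
      rw [qPoch_succ', qPoch_succ']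
      ring_nf
    rw [mul_assoc, ← e, qPoch_succ, qPoch_succ, qPoch_succ]
    ring
  have h3 : 1 - Q * q ^ 3 ≠ 0 := by simpa using hQ 0
  have h5 : 1 - Q * q ^ 5 ≠ 0 := by convert hQ 1 using 2; ring
  have hW' : (qPoch (Q * q ^ 4 * q ^ 3) (q ^ 2) (k + 1))⁻¹ =
      ((1 - Q * q ^ 3) * (1 - Q * q ^ 5)) * (qPoch (Q * q ^ 3) (q ^ 2) k *
        ((1 - Q * q ^ 3 * q ^ (2 * k)) *
        (1 - Q * q ^ 5 * q ^ (2 * k)) * (1 - Q * q ^ 7 * q ^ (2 * k))))⁻¹ := by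
    rw [← hW, mul_inv, mul_inv_cancel_left₀ (mul_ne_zero h3 h5)]
  simp only [cubicTerm, hV, h1, div_eq_mul_inv]
  rw [mul_inv _ (qPoch (Q * q ^ 4 * q ^ 3) (q ^ 2) (k + 1)), hW']
  simp only [qPoch_succ, h2, h4, mul_inv]
  ring

lemma telescope_of_cleared (u : K) {X A B c S s R r H d₁ d₂ d₃ e₁ e₂ e₃ : K}
    (h₁ : d₁ ≠ 0) (h₂ : d₂ ≠ 0) (h₃ : d₃ ≠ 0) (g₁ : e₁ ≠ 0) (g₂ : e₂ ≠ 0) (g₃ : e₃ ≠ 0)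
    (h : X * d₁ * d₂ * d₃ * e₃ + c * (A * S * s - B * R * r * e₂ * e₃) = R * r * H) :
    u * X / (e₁ * e₂) + c * (A * (u * (S / (d₁ * d₂ * d₃ * (e₁ * e₂ * e₃)) * s)) -
      B * (u * (R / (d₁ * d₂ * d₃ * e₁) * r))) =
    u * (R / (d₁ * d₂ * d₃ * e₁) * r) * H / (e₂ * e₃) := by
  field_simp
  linear_combination u * h

lemma sum_cubicTerm_shift {a q Q : K} (ha : a ≠ 0) (hq : q ≠ 0) (hQ0 : Q ≠ 0)
    (hQ : ∀ i, 1 - Q * q ^ 3 * (q ^ 2) ^ i ≠ 0)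
    (h1 : ∀ i, 1 - q ^ 4 * (q ^ 4) ^ i ≠ 0)
    (h2 : ∀ i, 1 - q ^ 4 / a * (q ^ 4) ^ i ≠ 0)
    (h3 : ∀ i, 1 - a * q ^ 4 * (q ^ 4) ^ i ≠ 0) (k : ℕ) :
    ∑ i ∈ Finset.range (k + 1), (1 - q ^ (6 * i + 1)) *
      ((1 - a * (Q * q ^ 4)) * (1 - Q * q ^ 4 / a) * cubicTerm a q (Q * q ^ 4) i -
        (1 - Q * q ^ 3) * (1 - Q * q ^ 5) * cubicTerm a q Q i) = cubicCert a q Q k := by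
  have hq5 : ∀ i, 1 - Q * q ^ 5 * q ^ (2 * i) ≠ 0 := fun i => by
    convert hQ (i + 1) using 2; ring
  have hq7 : ∀ i, 1 - Q * q ^ 7 * q ^ (2 * i) ≠ 0 := fun i => by
    convert hQ (i + 2) using 2; ring
  have hq3 : ∀ i, 1 - Q * q ^ 3 * q ^ (2 * i) ≠ 0 := fun i => by
    convert hQ i using 2; ring
  induction k with
  | zero =>
    have e3 := hq3 0
    have e5 := hq5 0
    simp only [mul_zero, pow_zero, mul_one] at e3 e5
    simp only [zero_add, Finset.sum_range_one, cubicCert, cubicTerm_zero, mul_zero, pow_zero,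
      mul_one]
    rw [eq_div_iff (mul_ne_zero e3 e5)]
    field_simp
    ring
  | succ k ih =>
    rw [Finset.sum_range_succ, ih, cubicTerm_shift_succ hq hQ, cubicCert, cubicCert,
      cubicTerm_succ]
    have e1 := h1 k
    have e2 := h2 k
    have e3 := h3 k
    have f3 := hq3 k
    have f5 := hq5 k
    have f7 := hq7 k
    have h4 : (q ^ 4) ^ k = (q ^ (2 * k)) ^ 2 := by ring
    have g1 : q ^ (6 * (k + 1) + 1) = q ^ 7 * (q ^ (2 * k)) ^ 3 := by ring
    have g2 : q ^ (2 * (k + 1)) = q ^ 2 * q ^ (2 * k) := by ring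
    rw [h4] at e1 e2 e3
    rw [g1, g2]
    generalize q ^ (2 * k) = y at *
    generalize cubicTerm a q Q k = u
    rw [show Q * q ^ 3 * (q ^ 2 * y) = Q * q ^ 5 * y by ring,
      show Q * q ^ 5 * (q ^ 2 * y) = Q * q ^ 7 * y by ring]
    clear h1 h2 h3 hq3 hq5 hq7 ih hQ
    refine telescope_of_cleared u e1 e2 e3 f3 f5 f7 ?_
    clear e1 e2 e3 f3 f5 f7
    field_simp
    ring

theorem sum_cubicTerm {a q : K} (ha : a ≠ 0) (hq : q ≠ 0) (hq1 : ∀ m : ℕ, 0 < m → q ^ m ≠ 1)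
    (haq : ∀ m : ℕ, a * q ^ m ≠ 1) (hqa : ∀ m : ℕ, q ^ m ≠ a) {N M : ℕ} (hNM : N ≤ M) :
    ∑ k ∈ Finset.range (M + 1), (1 - q ^ (6 * k + 1)) * cubicTerm a q (q ^ (4 * N)) k =
      (1 - q) * (qPoch (q ^ 3) (q ^ 4) N * qPoch (q ^ 5) (q ^ 4) N /
        (qPoch (a * q ^ 4) (q ^ 4) N * qPoch (q ^ 4 / a) (q ^ 4) N)) := by
  have hvan : ∀ {N k : ℕ}, N < k → cubicTerm a q (q ^ (4 * N)) k = 0 := fun {N k} h => by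
    rw [cubicTerm, pow_mul q 4 N, qPoch_inv_pow_eq_zero (pow_ne_zero 4 hq) h]
    simp
  have h1 : ∀ i, 1 - q ^ 4 * (q ^ 4) ^ i ≠ 0 := fun i h =>
    hq1 (4 * (i + 1)) (by omega) (by linear_combination -h)
  have h2 : ∀ i, 1 - q ^ 4 / a * (q ^ 4) ^ i ≠ 0 := fun i h => by
    refine hqa (4 * (i + 1)) ?_
    field_simp at h
    linear_combination -h
  have h3 : ∀ i, 1 - a * q ^ 4 * (q ^ 4) ^ i ≠ 0 := fun i h =>
    haq (4 * (i + 1)) (by linear_combination -h)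
  induction N with
  | zero =>
    rw [Finset.sum_range_succ', Finset.sum_eq_zero fun k _ => by rw [hvan k.succ_pos, mul_zero]]
    simp [cubicTerm, qPoch]
  | succ N ih =>
    have hQ : ∀ i, 1 - q ^ (4 * N) * q ^ 3 * (q ^ 2) ^ i ≠ 0 := fun i h =>
      hq1 (4 * N + 3 + 2 * i) (by omega) (by linear_combination -h)
    have key := sum_cubicTerm_shift ha hq (pow_ne_zero (4 * N) hq) hQ h1 h2 h3 M
    rw [cubicCert, hvan hNM, zero_mul, zero_div] at key
    have e : q ^ (4 * (N + 1)) = q ^ (4 * N) * q ^ 4 := by ring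
    have hA : 1 - a * (q ^ (4 * N) * q ^ 4) ≠ 0 := by convert h3 N using 2; ring
    have hB : 1 - q ^ (4 * N) * q ^ 4 / a ≠ 0 := by convert h2 N using 2; ring
    have key' : (1 - a * (q ^ (4 * N) * q ^ 4)) * (1 - q ^ (4 * N) * q ^ 4 / a) *
        ∑ k ∈ Finset.range (M + 1), (1 - q ^ (6 * k + 1)) * cubicTerm a q (q ^ (4 * (N + 1))) k =
        (1 - q ^ (4 * N) * q ^ 3) * (1 - q ^ (4 * N) * q ^ 5) *
        ∑ k ∈ Finset.range (M + 1), (1 - q ^ (6 * k + 1)) * cubicTerm a q (q ^ (4 * N)) k := by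
      rw [← sub_eq_zero, Finset.mul_sum, Finset.mul_sum, ← Finset.sum_sub_distrib, ← key, e]
      exact Finset.sum_congr rfl fun k _ => by ring
    rw [ih (by omega)] at key'
    refine mul_left_cancel₀ (mul_ne_zero hA hB) (key'.trans ?_)
    have g : (q ^ 4) ^ N = q ^ (4 * N) := (pow_mul q 4 N).symm
    have hA' : 1 - a * q ^ 4 * q ^ (4 * N) = 1 - a * (q ^ (4 * N) * q ^ 4) := by ring
    have hB' : 1 - q ^ 4 / a * q ^ (4 * N) = 1 - q ^ (4 * N) * q ^ 4 / a := by ring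
    simp only [qPoch_succ, g, hA', hB']
    have hC := qPoch_ne_zero h3 N
    have hD := qPoch_ne_zero h2 N
    clear key key' ih
    generalize 1 - q ^ (4 * N) * q ^ 4 / a = B at *
    generalize 1 - a * (q ^ (4 * N) * q ^ 4) = A at *
    generalize qPoch (a * q ^ 4) (q ^ 4) N = C at *
    generalize qPoch (q ^ 4 / a) (q ^ 4) N = D at *
    rw [show q ^ 3 * q ^ (4 * N) = q ^ (4 * N) * q ^ 3 from mul_comm _ _,
      show q ^ 5 * q ^ (4 * N) = q ^ (4 * N) * q ^ 5 from mul_comm _ _]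
    field_simp

end qPochhammer

lemma qv_pow_ne_one {m : ℕ} (hm : 0 < m) : qv ^ m ≠ 1 := by
  rw [qv, ← map_pow, ← map_one (algebraMap (MvPolynomial (Fin 2) ℚ) Qaq)]
  intro h
  have := congrArg (MvPolynomial.eval (0 : Fin 2 → ℚ))
    (IsFractionRing.injective (MvPolynomial (Fin 2) ℚ) Qaq h)
  simp [hm.ne'] at this

lemma av_mul_qv_pow_ne_one (m : ℕ) : av * qv ^ m ≠ 1 := by
  rw [av, qv, ← map_pow, ← map_mul, ← map_one (algebraMap (MvPolynomial (Fin 2) ℚ) Qaq)]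
  intro h
  have := congrArg (MvPolynomial.eval (0 : Fin 2 → ℚ))
    (IsFractionRing.injective (MvPolynomial (Fin 2) ℚ) Qaq h)
  simp at this

lemma qv_pow_ne_av (m : ℕ) : qv ^ m ≠ av := by
  rw [av, qv, ← map_pow]
  intro h
  have := congrArg (MvPolynomial.eval (![0, 1] : Fin 2 → ℚ))
    (IsFractionRing.injective (MvPolynomial (Fin 2) ℚ) Qaq h)
  simp at this

lemma algebraMap_X_ne_zero (i : Fin 2) :
    algebraMap (MvPolynomial (Fin 2) ℚ) Qaq (MvPolynomial.X i) ≠ 0 := fun h =>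
  MvPolynomial.X_ne_zero i (IsFractionRing.injective (MvPolynomial (Fin 2) ℚ) Qaq
    (h.trans (map_zero _).symm))

theorem stmt_15 (n : ℕ) (hn : 0 < n) (h4 : n % 4 = 1) (M : ℕ)
    (hM : M = (n - 1) / 2 ∨ M = n - 1) :
    (∑ k ∈ Finset.range (M + 1),
        qint qv (6 * k + 1) *
          (qPoch qv (qv ^ 2) k * qPoch (av * qv) (qv ^ 2) k *
            qPoch (qv / av) (qv ^ 2) k) *
          qPoch (qv ^ ((1 : ℤ) - n)) (qv ^ 4) k /
          ((qPoch (qv ^ 4) (qv ^ 4) k * qPoch (qv ^ 4 / av) (qv ^ 4) k *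
              qPoch (av * qv ^ 4) (qv ^ 4) k) *
            qPoch (qv ^ (2 + n)) (qv ^ 2) k) *
          qv ^ (k ^ 2 + k + n * k)) =
      qPoch (qv ^ 3) (qv ^ 4) ((n - 1) / 4) *
          qPoch (qv ^ 5) (qv ^ 4) ((n - 1) / 4) /
        (qPoch (av * qv ^ 4) (qv ^ 4) ((n - 1) / 4) *
          qPoch (qv ^ 4 / av) (qv ^ 4) ((n - 1) / 4)) := by
  obtain ⟨N, rfl⟩ : ∃ N, n = 4 * N + 1 := ⟨n / 4, by omega⟩
  have hNM : N ≤ M := by omega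
  have hN : (4 * N + 1 - 1) / 4 = N := by omega
  have ha0 : av ≠ 0 := algebraMap_X_ne_zero 0
  have hq0 : qv ≠ 0 := algebraMap_X_ne_zero 1
  have hq1 : 1 - qv ≠ 0 := fun h =>
    qv_pow_ne_one one_pos ((pow_one qv).trans (sub_eq_zero.1 h).symm)
  rw [hN]
  apply mul_left_cancel₀ hq1
  rw [← sum_cubicTerm ha0 hq0 (fun m => qv_pow_ne_one)
    av_mul_qv_pow_ne_one qv_pow_ne_av hNM, Finset.mul_sum]
  refine Finset.sum_congr rfl fun k _ => ?_
  have e1 : qv ^ ((1 : ℤ) - (4 * N + 1 : ℕ)) = (qv ^ (4 * N))⁻¹ := by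
    rw [← zpow_natCast, ← zpow_neg]
    congr 1
    push_cast
    ring
  have e2 : qv ^ (2 + (4 * N + 1)) = qv ^ (4 * N) * qv ^ 3 := by ring
  have e3 : qv ^ (k ^ 2 + k + (4 * N + 1) * k) =
      qv ^ (k ^ 2 + k) * (qv ^ (4 * N) * qv) ^ k := by
    rw [pow_add, pow_mul, pow_succ qv (4 * N)]
  rw [e1, e2, e3, ← qint_mul_one_sub, cubicTerm]
  ring
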